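/- Let M > 0 and let (f_n) be a sequence of continuous real-valued functions on [0,1] such that (1/M)·‖(λ_1,…,λ_n,0,…)‖_J ≤ ‖λ_1 f_1 + ⋯ + λ_n f_n‖_∞ ≤ M·‖(λ_1,…,λ_n,0,…)‖_J for every n and all reals λ_1, …, λ_n. Define g_n(a,b) = f_n(a)·max(0, 1 − 2ⁿ b) on K = [0,1]². Then for every n ∈ ℕ and all real numbers λ_1, …, λ_n, one has (1/M)·‖(λ_1,…,λ_n,0,…)‖_J ≤ ‖λ_1 g_1 + ⋯ + λ_n g_n‖_{C(K)} ≤ 2M·‖(λ_1,…,λ_n,0,…)‖_J, where ‖·‖_{C(K)} is the supremum norm on K. -/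

import Mathlib

open unitInterval

/-- The James norm of a sequence `x = (x₀, x₁, x₂, …)` of real numbers (the sequence is
indexed starting at `0`, corresponding to the paper's `x₁, x₂, …`):
`‖x‖_J = sup { √(x_{p 0}² + (x_{p 1} − x_{p 0})² + ⋯ + (x_{p k} − x_{p (k−1)})²) :
  k ∈ ℕ, p : ℕ → ℕ strictly increasing }`. -/
noncomputable def jamesNorm (x : ℕ → ℝ) : ℝ :=
  sSup {r : ℝ | ∃ (k : ℕ) (p : ℕ → ℕ), StrictMono p ∧
    r = Real.sqrt ((x (p 0)) ^ 2 + ∑ i ∈ Finset.range k, (x (p (i + 1)) - x (p i)) ^ 2)}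

/-- `g_n ∈ C(K)`, `K = [0,1]²`, given by `g_n(a,b) = f_n(a) · max(0, 1 − 2ⁿ b)`. -/
noncomputable def gMap (f : ℕ → C(I, ℝ)) (n : ℕ) : C(I × I, ℝ) :=
  ⟨fun p => f n p.1 * max 0 (1 - 2 ^ n * (p.2 : ℝ)), by fun_prop⟩

open Finset in
/-- Abel's inequality: weights `t` decreasing in `[0, 1]` do not increase a bound on the partial
sums. -/
theorem abs_sum_antitone_mul_le {t v : ℕ → ℝ} {B : ℝ} (ht : Antitone t) (ht0 : ∀ i, 0 ≤ t i)
    (ht1 : t 0 ≤ 1) {n : ℕ} (hv : ∀ m ≤ n, |∑ i ∈ Icc 1 m, v i| ≤ B) :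
    |∑ i ∈ Icc 1 n, t i * v i| ≤ B := by
  have hB : 0 ≤ B := (abs_nonneg _).trans (hv 0 (Nat.zero_le n))
  have key : ∀ m ≤ n, |∑ i ∈ Icc 1 m, t i * v i - t m * ∑ i ∈ Icc 1 m, v i|
      ≤ (t 0 - t m) * B := by
    intro m
    induction m with
    | zero => simp
    | succ m ih =>
      intro hm
      have h1 := ih (by omega)
      have h2 : |(t m - t (m + 1)) * ∑ i ∈ Icc 1 m, v i| ≤ (t m - t (m + 1)) * B := by
        have h3 : 0 ≤ t m - t (m + 1) := sub_nonneg.2 (ht m.le_succ)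
        rw [abs_mul, abs_of_nonneg h3]
        exact mul_le_mul_of_nonneg_left (hv m (by omega)) h3
      rw [sum_Icc_succ_top (by omega), sum_Icc_succ_top (by omega)]
      calc _ = |(∑ i ∈ Icc 1 m, t i * v i - t m * ∑ i ∈ Icc 1 m, v i)
            + (t m - t (m + 1)) * ∑ i ∈ Icc 1 m, v i| := by congr 1; ring
        _ ≤ _ := abs_add_le _ _
        _ ≤ _ := by linarith
  have h1 := key n le_rfl
  have h2 : |t n * ∑ i ∈ Icc 1 n, v i| ≤ t n * B := by
    rw [abs_mul, abs_of_nonneg (ht0 n)]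
    exact mul_le_mul_of_nonneg_left (hv n le_rfl) (ht0 n)
  calc |∑ i ∈ Icc 1 n, t i * v i|
      = |(∑ i ∈ Icc 1 n, t i * v i - t n * ∑ i ∈ Icc 1 n, v i) + t n * ∑ i ∈ Icc 1 n, v i| := by
        congr 1; ring
    _ ≤ _ := abs_add_le _ _
    _ ≤ t 0 * B := by linarith
    _ ≤ B := mul_le_of_le_one_left hB ht1

/-- The square variation of `x` along `p 0 < ⋯ < p k`, including the initial term `x (p 0) ^ 2`. -/
def jamesVariation (x : ℕ → ℝ) (k : ℕ) (p : ℕ → ℕ) : ℝ :=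
  (x (p 0)) ^ 2 + ∑ i ∈ Finset.range k, (x (p (i + 1)) - x (p i)) ^ 2

theorem jamesVariation_succ (x : ℕ → ℝ) (k : ℕ) (p : ℕ → ℕ) :
    jamesVariation x (k + 1) p = jamesVariation x k p + (x (p (k + 1)) - x (p k)) ^ 2 := by
  simp only [jamesVariation, Finset.sum_range_succ, add_assoc]

theorem jamesVariation_add_le (x : ℕ → ℝ) (k : ℕ) {p : ℕ → ℕ} (hp : StrictMono p) :
    jamesVariation x k p + 2 * x (p k) ^ 2 ≤ 4 * ∑ i ∈ Finset.range (p k + 1), x i ^ 2 := by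
  induction k with
  | zero =>
    have h := Finset.sum_nonneg fun i (_ : i ∈ Finset.range (p 0)) => sq_nonneg (x i)
    rw [Finset.sum_range_succ]
    simp only [jamesVariation, Finset.range_zero, Finset.sum_empty]
    nlinarith [sq_nonneg (x (p 0))]
  | succ k ih =>
    have h : ∑ i ∈ Finset.range (p k + 1), x i ^ 2 ≤ ∑ i ∈ Finset.range (p (k + 1)), x i ^ 2 :=
      Finset.sum_le_sum_of_subset_of_nonneg
        (Finset.range_subset_range.2 (hp k.lt_succ_self)) fun i _ _ => sq_nonneg _
    rw [Finset.sum_range_succ, jamesVariation_succ]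
    nlinarith [sq_nonneg (x (p (k + 1)) + x (p k))]

/-- For a finitely supported sequence, the squared James norm bounds every square variation. -/
theorem jamesVariation_le_sq_jamesNorm {x : ℕ → ℝ} {n : ℕ} (hx : ∀ j, n ≤ j → x j = 0)
    (k : ℕ) {p : ℕ → ℕ} (hp : StrictMono p) : jamesVariation x k p ≤ jamesNorm x ^ 2 := by
  have hbdd : BddAbove {r : ℝ | ∃ (k : ℕ) (p : ℕ → ℕ), StrictMono p ∧
      r = Real.sqrt (jamesVariation x k p)} := by
    refine ⟨Real.sqrt (4 * ∑ i ∈ Finset.range n, x i ^ 2), ?_⟩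
    rintro _ ⟨k, p, hp, rfl⟩
    apply Real.sqrt_le_sqrt
    have h1 := jamesVariation_add_le x k hp
    have h2 : ∑ i ∈ Finset.range (p k + 1), x i ^ 2 ≤ ∑ i ∈ Finset.range n, x i ^ 2 := by
      rcases le_total (p k + 1) n with h | h
      · exact Finset.sum_le_sum_of_subset_of_nonneg (Finset.range_subset_range.2 h)
          fun i _ _ => sq_nonneg _
      · refine (Finset.sum_subset (Finset.range_subset_range.2 h) fun i _ hi => ?_).ge
        rw [hx i (by simpa using hi)]
        norm_num
    nlinarith [sq_nonneg (x (p k))]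
  exact (Real.sqrt_le_iff.1 (le_csSup hbdd ⟨k, p, hp, rfl⟩)).2

theorem jamesNorm_nonneg (x : ℕ → ℝ) : 0 ≤ jamesNorm x := by
  apply Real.sSup_nonneg
  rintro _ ⟨k, p, _, rfl⟩
  exact Real.sqrt_nonneg _

/-- Truncating a finitely supported sequence at most doubles its James norm. -/
theorem jamesNorm_truncate_le {x y : ℕ → ℝ} {n m : ℕ} (hx : ∀ j, n ≤ j → x j = 0)
    (hyx : ∀ j, j < m → y j = x j) (hy : ∀ j, m ≤ j → y j = 0) :
    jamesNorm y ≤ 2 * jamesNorm x := by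
  have hN := jamesNorm_nonneg x
  apply Real.sSup_le _ (by positivity)
  rintro _ ⟨k, p, hp, rfl⟩
  have hvar : ∀ k, (p k < m → jamesVariation y k p = jamesVariation x k p) ∧
      (m ≤ p k → jamesVariation y k p ≤ 2 * jamesNorm x ^ 2) := by
    intro k
    induction k with
    | zero =>
      refine ⟨fun h => by simp [jamesVariation, hyx _ h], fun h => ?_⟩
      simp only [jamesVariation, hy _ h, Finset.range_zero, Finset.sum_empty]
      nlinarith [sq_nonneg (jamesNorm x)]
    | succ k ih =>
      have hlt := hp k.lt_succ_self
      rw [jamesVariation_succ, jamesVariation_succ]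
      refine ⟨fun h => ?_, fun h => ?_⟩
      · rw [ih.1 (hlt.trans h), hyx _ h, hyx _ (hlt.trans h)]
      · rw [hy _ h]
        rcases lt_or_ge (p k) m with hk | hk
        · have h1 := jamesVariation_le_sq_jamesNorm hx k hp
          have h2 := jamesVariation_le_sq_jamesNorm hx 0 (p := fun i => i + p k)
            (fun a b hab => by simpa using hab)
          simp only [jamesVariation, Finset.range_zero, Finset.sum_empty, zero_add, add_zero] at h2
          rw [ih.1 hk, hyx _ hk]
          linarith
        · have h1 := ih.2 hk
          rw [hy _ hk]
          linarith
  have h : jamesVariation y k p ≤ 2 * jamesNorm x ^ 2 := by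
    rcases lt_or_ge (p k) m with hk | hk
    · rw [(hvar k).1 hk]
      nlinarith [jamesVariation_le_sq_jamesNorm hx k hp, sq_nonneg (jamesNorm x)]
    · exact (hvar k).2 hk
  refine Real.sqrt_le_iff.2 ⟨by positivity, h.trans ?_⟩
  nlinarith [sq_nonneg (jamesNorm x)]

/-- Let `M > 0` and `(f_n)` be a sequence of continuous real-valued functions on `[0,1]`
such that `(1/M)·‖(λ_1,…,λ_n,0,…)‖_J ≤ ‖λ_1 f_1 + ⋯ + λ_n f_n‖_∞ ≤ M·‖(λ_1,…,λ_n,0,…)‖_J`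
for every `n` and all reals `λ_1, …, λ_n`.  With `g_n(a,b) = f_n(a)·max(0, 1 − 2ⁿ b)`
on `K = [0,1]²`, for every `n` and all reals `λ_1, …, λ_n` one has
`(1/M)·‖(λ_1,…,λ_n,0,…)‖_J ≤ ‖λ_1 g_1 + ⋯ + λ_n g_n‖_{C(K)} ≤ 2M·‖(λ_1,…,λ_n,0,…)‖_J`. -/
theorem gMap_sum_norm_equiv_james (M : ℝ) (hM : 0 < M) (f : ℕ → C(I, ℝ))
    (hf : ∀ (n : ℕ) (lam : ℕ → ℝ),
      (1 / M) * jamesNorm (fun j => if j < n then lam (j + 1) else 0) ≤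
        ‖∑ i ∈ Finset.Icc 1 n, lam i • f i‖ ∧
      ‖∑ i ∈ Finset.Icc 1 n, lam i • f i‖ ≤
        M * jamesNorm (fun j => if j < n then lam (j + 1) else 0)) :
    ∀ (n : ℕ) (lam : ℕ → ℝ),
      (1 / M) * jamesNorm (fun j => if j < n then lam (j + 1) else 0) ≤
        ‖∑ i ∈ Finset.Icc 1 n, lam i • gMap f i‖ ∧
      ‖∑ i ∈ Finset.Icc 1 n, lam i • gMap f i‖ ≤
        2 * M * jamesNorm (fun j => if j < n then lam (j + 1) else 0) := by
  intro n lam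
  constructor
  · refine (hf n lam).1.trans ((ContinuousMap.norm_le _ (norm_nonneg _)).2 fun a => ?_)
    have h := (∑ i ∈ Finset.Icc 1 n, lam i • gMap f i).norm_coe_le_norm (a, 0)
    simpa [gMap, ContinuousMap.sum_apply] using h
  · set x : ℕ → ℝ := fun j => if j < n then lam (j + 1) else 0 with hxdef
    have hN := jamesNorm_nonneg x
    refine (ContinuousMap.norm_le _ (by positivity)).2 fun q => ?_
    have hb := q.2.2.1
    have h := abs_sum_antitone_mul_le (t := fun i => max 0 (1 - 2 ^ i * (q.2 : ℝ)))
      (v := fun i => lam i * f i q.1) (B := 2 * M * jamesNorm x) (n := n)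
      (fun i j hij => by
        have h2 : (2 : ℝ) ^ i ≤ 2 ^ j := pow_le_pow_right₀ (by norm_num) hij
        dsimp only
        gcongr)
      (fun i => le_max_left _ _) (by simpa using hb) (fun m hm => ?_)
    · rw [ContinuousMap.sum_apply, Real.norm_eq_abs]
      refine le_of_eq_of_le (congrArg _ (Finset.sum_congr rfl fun i _ => ?_)) h
      simp only [gMap, ContinuousMap.smul_apply, ContinuousMap.coe_mk, smul_eq_mul]
      ring
    · have h1 := (∑ i ∈ Finset.Icc 1 m, lam i • f i).norm_coe_le_norm q.1
      simp only [ContinuousMap.sum_apply, ContinuousMap.smul_apply, smul_eq_mul,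
        Real.norm_eq_abs] at h1
      have h2 : jamesNorm (fun j => if j < m then lam (j + 1) else 0) ≤ 2 * jamesNorm x :=
        jamesNorm_truncate_le (n := n) (m := m)
          (fun j hj => if_neg (not_lt.2 hj))
          (fun j hj => by simp [hxdef, hj, hj.trans_le hm])
          (fun j hj => if_neg (not_lt.2 hj))
      calc _ ≤ _ := h1
        _ ≤ _ := (hf m lam).2
        _ ≤ M * (2 * jamesNorm x) := mul_le_mul_of_nonneg_left h2 hM.le
        _ = _ := by ring
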